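/- For every n ≥ 1, there is a bijection between the set of transitive triples (α, β, γ) of fixed-point-free involutions on Fin n with a chosen root convention (equivalently, the set of rooted connected pavings on n darts) modulo relabelling fixing the root, and the set of free subgroups of index n in Δ⁺ = ℤ/2 * ℤ/2 * ℤ/2. Consequently, the number of subgroups H ≤ Δ⁺ with index n and H free equals c(n)/(n−1)!, where c(n) is the number of transitive triples of fixed-point-free involutions on Fin n. -/

import Mathlib

/-- `Δ⁺ = ℤ/2 * ℤ/2 * ℤ/2`, the free product of three copies of the cyclic
group of order two. -/
abbrev Delta : Type := Monoid.CoprodI (fun _ : Fin 3 => Multiplicative (ZMod 2))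

/-- A fixed-point-free involution: a permutation `σ` with `σ ∘ σ = id` and no
fixed point. -/
def IsFPFInvolution {D : Type*} (σ : Equiv.Perm D) : Prop :=
  σ * σ = 1 ∧ ∀ x, σ x ≠ x

/-- A transitive triple on `Fin n`: a triple of fixed-point-free involutions
generating a subgroup that acts transitively on `Fin n`. -/
def IsTransitiveTriple {n : ℕ}
    (t : Equiv.Perm (Fin n) × Equiv.Perm (Fin n) × Equiv.Perm (Fin n)) : Prop :=
  (IsFPFInvolution t.1 ∧ IsFPFInvolution t.2.1 ∧ IsFPFInvolution t.2.2) ∧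
    ∀ x y : Fin n, ∃ g ∈ Subgroup.closure ({t.1, t.2.1, t.2.2} :
      Set (Equiv.Perm (Fin n))), g x = y

/-- `c(n)`: the number of transitive triples on `Fin n`. -/
noncomputable def cTrans (n : ℕ) : ℕ :=
  Nat.card {t : Equiv.Perm (Fin n) × Equiv.Perm (Fin n) × Equiv.Perm (Fin n) //
    IsTransitiveTriple t}

open CategoryTheory CategoryTheory.ActionCategory

section FreeAction

/-- The homomorphism out of the cyclic group of order two determined by an element whose square
is trivial. -/
def homOfMulSelfEqOne {N : Type*} [Monoid N] (g : N) (h : g * g = 1) :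
    Multiplicative (ZMod 2) →* N where
  toFun m := if m = 1 then 1 else g
  map_one' := if_pos rfl
  map_mul' x y := by
    have key : ∀ x y : Multiplicative (ZMod 2),
        (x = 1 ∧ x * y = y) ∨ (y = 1 ∧ x * y = x) ∨ (x ≠ 1 ∧ y ≠ 1 ∧ x * y = 1) := by decide
    rcases key x y with ⟨hx, hxy⟩ | ⟨hy, hxy⟩ | ⟨hx, hy, hxy⟩ <;> simp [*]

theorem homOfMulSelfEqOne_ofAdd_one {N : Type*} [Monoid N] (g : N) (h : g * g = 1) :
    homOfMulSelfEqOne g h (Multiplicative.ofAdd 1) = g := by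
  have h1 : Multiplicative.ofAdd (1 : ZMod 2) ≠ 1 := by decide
  simp [homOfMulSelfEqOne, h1]

theorem hom_ext_multiplicative_zmod_two {N : Type*} [Monoid N]
    {f g : Multiplicative (ZMod 2) →* N}
    (h : f (Multiplicative.ofAdd 1) = g (Multiplicative.ofAdd 1)) : f = g := by
  refine MonoidHom.ext fun x => ?_
  have key : ∀ x : Multiplicative (ZMod 2), x = 1 ∨ x = Multiplicative.ofAdd 1 := by decide
  rcases key x with rfl | rfl
  · rw [map_one, map_one]
  · exact h

/-- A point stabilizer is a vertex group of the action groupoid. -/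
theorem isFreeGroup_stabilizer_of_isFreeGroupoid {G A : Type} [Group G] [MulAction G A]
    [MulAction.IsPretransitive G A] [IsFreeGroupoid (ActionCategory G A)] (a : A) :
    IsFreeGroup (MulAction.stabilizer G a) := by
  have : Nonempty A := ⟨a⟩
  let r : ActionCategory G A := objEquiv G A a
  have hconn : @IsConnected (ActionCategory G A) Groupoid.toCategory :=
    (inferInstance : IsConnected (ActionCategory G A))
  have hfree := IsFreeGroupoid.endIsFreeOfConnectedFree r
  exact IsFreeGroup.ofMulEquiv (G := @End (ActionCategory G A) Groupoid.toCategory.toCategoryStruct r)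
    { toFun := fun f => ⟨f.1, f.2⟩
      invFun := fun g => ⟨g.1, g.2⟩
      left_inv := fun _ => rfl
      right_inv := fun _ => rfl
      map_mul' := fun _ _ => rfl }

theorem IsFreeGroup.eq_one_of_mul_self_eq_one {G : Type*} [Group G] [IsFreeGroup G] {g : G}
    (h : g * g = 1) : g = 1 := by
  apply (IsFreeGroup.toFreeGroup G).injective
  rw [map_one]
  refine (isOfFinOrder_iff_eq_one _).mp (isOfFinOrder_iff_pow_eq_one.mpr ⟨2, two_pos, ?_⟩)
  rw [pow_two, ← map_mul, h, map_one]

/-- The free product of copies of the cyclic group of order two indexed by `ι`. -/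
abbrev InvolutionCoprod (ι : Type*) := Monoid.CoprodI (fun _ : ι => Multiplicative (ZMod 2))

namespace InvolutionCoprod

variable {ι : Type}

/-- The involution generating the `i`-th factor. -/
def gen (i : ι) : InvolutionCoprod ι :=
  Monoid.CoprodI.of (M := fun _ : ι => Multiplicative (ZMod 2)) (i := i) (Multiplicative.ofAdd 1)

theorem gen_mul_self (i : ι) : gen i * gen i = 1 := by
  rw [gen, ← map_mul, show Multiplicative.ofAdd (1 : ZMod 2) * Multiplicative.ofAdd 1 = 1 by decide,
    map_one]

theorem gen_inv (i : ι) : (gen i)⁻¹ = gen i :=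
  inv_eq_of_mul_eq_one_left (gen_mul_self i)

theorem gen_ne_one (i : ι) : gen i ≠ 1 := fun h => by
  have := Monoid.CoprodI.of_injective (M := fun _ : ι => Multiplicative (ZMod 2)) i
    (h.trans (map_one _).symm)
  exact absurd this (by decide)

/-- The universal property: a family of elements with trivial squares extends to the coproduct. -/
def lift {N : Type*} [Monoid N] (s : ι → N) (hs : ∀ i, s i * s i = 1) :
    InvolutionCoprod ι →* N :=
  Monoid.CoprodI.lift fun i => homOfMulSelfEqOne (s i) (hs i)

@[simp]
theorem lift_gen {N : Type*} [Monoid N] (s : ι → N) (hs : ∀ i, s i * s i = 1) (i : ι) :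
    lift s hs (gen i) = s i := by
  simp [lift, gen, homOfMulSelfEqOne_ofAdd_one]

theorem hom_ext {N : Type*} [Monoid N] {f g : InvolutionCoprod ι →* N}
    (h : ∀ i, f (gen i) = g (gen i)) : f = g :=
  Monoid.CoprodI.ext_hom _ _ fun i => hom_ext_multiplicative_zmod_two (h i)

/-- If the generating involutions act without fixed points, then the action groupoid is free: a
generating quiver is obtained by orienting each orbit of each involution. -/
@[reducible]
noncomputable def isFreeGroupoid {A : Type} [LinearOrder A] [MulAction (InvolutionCoprod ι) A]
    (hfix : ∀ (i : ι) (a : A), gen i • a ≠ a) :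
    IsFreeGroupoid (ActionCategory (InvolutionCoprod ι) A) where
  quiverGenerators := ⟨fun a b => {i : ι // a.back < b.back ∧ gen i • a.back = b.back}⟩
  of := fun e => ⟨gen e.1, e.2.2⟩
  unique_lift := by
    intro X _ f
    classical
    let φ : ι → A → A → X := fun i a b =>
      if h : a < b ∧ gen i • a = b then @f ⟨(), a⟩ ⟨(), b⟩ ⟨i, h⟩ else 1
    let L : ι → A → X := fun i b => φ i (gen i • b) b * (φ i b (gen i • b))⁻¹
    have hgg : ∀ (i : ι) (b : A), gen i • gen i • b = b := fun i b => by
      rw [smul_smul, gen_mul_self, one_smul]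
    have hL : ∀ (i : ι) (b : A), L i b * L i (gen i • b) = 1 := fun i b => by
      simp only [L, hgg]
      group
    have hLlt : ∀ (i : ι) (a b : A) (h : a < b ∧ gen i • a = b),
        L i b = @f ⟨(), a⟩ ⟨(), b⟩ ⟨i, h⟩ := by
      rintro i a b ⟨hlt, rfl⟩
      have h1 : φ i a (gen i • a) = @f ⟨(), a⟩ ⟨(), gen i • a⟩ ⟨i, hlt, rfl⟩ := dif_pos ⟨hlt, rfl⟩
      have h2 : φ i (gen i • a) a = 1 := dif_neg fun h => lt_asymm h.1 hlt
      simp only [L, hgg]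
      rw [h1, h2, inv_one, mul_one]
    let f' : ι → (A → X) ⋊[mulAutArrow] (InvolutionCoprod ι) := fun i => ⟨L i, gen i⟩
    have hf' : ∀ i, f' i * f' i = 1 := fun i => by
      ext b
      · change L i b * L i ((gen i)⁻¹ • b) = 1
        rw [gen_inv, hL]
      · exact gen_mul_self i
    refine ⟨uncurry (lift f' hf') ?_, ?_, ?_⟩
    · suffices SemidirectProduct.rightHom.comp (lift f' hf') = MonoidHom.id _ from
        fun g => DFunLike.congr_fun this g
      refine hom_ext fun i => ?_
      rw [MonoidHom.comp_apply, lift_gen]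
      rfl
    · rintro ⟨⟨⟩, a : A⟩ ⟨⟨⟩, b : A⟩ ⟨i, h⟩
      change (lift f' hf' (gen i)).left b = _
      rw [lift_gen]
      exact hLlt i a b h
    · intro E hE
      have : curry E = lift f' hf' := by
        refine hom_ext fun i => ?_
        rw [lift_gen]
        have hlt : ∀ (a b : A) (h : a < b ∧ gen i • a = b),
            (curry E (gen i)).left b = L i b := by
          intro a b h
          rw [hLlt i a b h]
          have hE' := hE ⟨(), a⟩ ⟨(), b⟩ ⟨i, h⟩
          rw [← hE']
          cases inv_smul_eq_iff.mpr h.2.symm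
          rfl
        have hmul : ∀ b : A, (curry E (gen i)).left b * (curry E (gen i)).left (gen i • b) = 1 := by
          intro b
          have h1 : curry E (gen i) * curry E (gen i) = 1 := by
            rw [← map_mul, gen_mul_self, map_one]
          have h2 := congrFun (congrArg SemidirectProduct.left h1) b
          change (curry E (gen i)).left b * (curry E (gen i)).left ((gen i)⁻¹ • b) = 1 at h2
          rwa [gen_inv] at h2
        ext b
        · change (curry E (gen i)).left b = L i b
          rcases lt_or_gt_of_ne (hfix i b) with h | h
          · exact hlt _ b ⟨h, hgg i b⟩
          · rw [eq_inv_of_mul_eq_one_left (hmul b), eq_inv_of_mul_eq_one_left (hL i b),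
              hlt b _ ⟨h, rfl⟩]
        · rfl
      apply Functor.hext
      · intro
        apply Unit.ext
      · refine ActionCategory.cases ?_
        intro t g
        exact heq_of_eq (congrFun (congrArg SemidirectProduct.left (DFunLike.congr_fun this g)) t)

theorem isFreeGroup_stabilizer {A : Type} [LinearOrder A] [MulAction (InvolutionCoprod ι) A]
    [MulAction.IsPretransitive (InvolutionCoprod ι) A]
    (hfix : ∀ (i : ι) (a : A), gen i • a ≠ a) (a : A) :
    IsFreeGroup (MulAction.stabilizer (InvolutionCoprod ι) a) := by
  let _ := isFreeGroupoid hfix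
  exact isFreeGroup_stabilizer_of_isFreeGroupoid a

/-- The generating involutions fix no coset of a free subgroup. -/
theorem gen_smul_ne {H : Subgroup (InvolutionCoprod ι)} (hH : IsFreeGroup H) (i : ι)
    (q : InvolutionCoprod ι ⧸ H) : gen i • q ≠ q := by
  induction q using QuotientGroup.induction_on with
  | H g =>
    intro h
    have hmem : g⁻¹ * (gen i * g) ∈ H := QuotientGroup.eq.mp h.symm
    have h1 : (⟨_, hmem⟩ : H) = 1 := IsFreeGroup.eq_one_of_mul_self_eq_one <| by
      ext
      change g⁻¹ * (gen i * g) * (g⁻¹ * (gen i * g)) = 1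
      rw [show g⁻¹ * (gen i * g) * (g⁻¹ * (gen i * g)) = g⁻¹ * (gen i * gen i) * g by group,
        gen_mul_self]
      group
    have h2 : g⁻¹ * (gen i * g) = 1 := congrArg Subtype.val h1
    refine gen_ne_one i ?_
    calc gen i = g * (g⁻¹ * (gen i * g)) * g⁻¹ := by group
      _ = 1 := by rw [h2]; group

theorem range_lift {N : Type*} [Group N] (s : ι → N) (hs : ∀ i, s i * s i = 1) :
    (lift s hs).range = Subgroup.closure (Set.range s) := by
  apply le_antisymm
  · refine Monoid.CoprodI.lift_range_le (G := fun _ : ι => Multiplicative (ZMod 2)) _ fun i => ?_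
    rintro _ ⟨x, rfl⟩
    change (if x = 1 then 1 else s i) ∈ _
    split_ifs
    · exact one_mem _
    · exact Subgroup.subset_closure ⟨i, rfl⟩
  · rw [Subgroup.closure_le]
    rintro _ ⟨i, rfl⟩
    exact ⟨gen i, lift_gen s hs i⟩

end InvolutionCoprod
end FreeAction

/-- Two transitive permutation representations with the same point stabilizer are conjugate by a
permutation fixing that point. -/
theorem exists_perm_conj_of_stabilizer_eq {G X : Type*} [Group G] (ρ σ : G →* Equiv.Perm X) (x₀ : X)
    (hρ : ∀ x, ∃ g, ρ g x₀ = x) (hσ : ∀ x, ∃ g, σ g x₀ = x)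
    (h : ∀ g, ρ g x₀ = x₀ ↔ σ g x₀ = x₀) :
    ∃ π : Equiv.Perm X, π x₀ = x₀ ∧ ∀ g, π * ρ g * π⁻¹ = σ g := by
  have key : ∀ g k, ρ g x₀ = ρ k x₀ ↔ σ g x₀ = σ k x₀ := fun g k => by
    have h' := h (k⁻¹ * g)
    simpa only [map_mul, map_inv, Equiv.Perm.mul_apply, Equiv.Perm.inv_eq_iff_eq] using h'
  choose f hf using hρ
  have hπ : ∀ g, σ (f (ρ g x₀)) x₀ = σ g x₀ := fun g => (key _ _).mp (hf _)
  let π : Equiv.Perm X := Equiv.ofBijective (fun x => σ (f x) x₀) ⟨fun x y hxy => by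
    rw [← hf x, ← hf y]; exact (key _ _).mpr hxy, fun y => by
    obtain ⟨g, rfl⟩ := hσ y
    exact ⟨ρ g x₀, hπ g⟩⟩
  have hπ' : ∀ g, π (ρ g x₀) = σ g x₀ := hπ
  refine ⟨π, by simpa using hπ' 1, fun g => mul_inv_eq_iff_eq_mul.mpr ?_⟩
  ext x
  have hx := hf x
  generalize f x = k at hx
  subst hx
  have := hπ' (g * k)
  simp only [map_mul, Equiv.Perm.mul_apply] at this ⊢
  rw [this, hπ']

open InvolutionCoprod

section Paving

variable {n : ℕ}

/-- The three permutations of a triple, as a family indexed by `Fin 3`. -/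
def tripleFamily (t : Equiv.Perm (Fin n) × Equiv.Perm (Fin n) × Equiv.Perm (Fin n)) :
    Fin 3 → Equiv.Perm (Fin n) :=
  ![t.1, t.2.1, t.2.2]

theorem range_tripleFamily (t : Equiv.Perm (Fin n) × Equiv.Perm (Fin n) × Equiv.Perm (Fin n)) :
    Set.range (tripleFamily t) = {t.1, t.2.1, t.2.2} := by
  ext x
  simp [tripleFamily]
  tauto

theorem isTransitiveTriple_iff
    (t : Equiv.Perm (Fin n) × Equiv.Perm (Fin n) × Equiv.Perm (Fin n)) :
    IsTransitiveTriple t ↔ (∀ i, IsFPFInvolution (tripleFamily t i)) ∧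
      ∀ x y : Fin n, ∃ g ∈ Subgroup.closure (Set.range (tripleFamily t)), g x = y := by
  rw [range_tripleFamily, IsTransitiveTriple, Fin.forall_fin_succ, Fin.forall_fin_succ,
    Fin.forall_fin_succ]
  simp [tripleFamily]

/-- The type of transitive triples on `Fin n`. -/
abbrev TransitiveTriple (n : ℕ) : Type :=
  {t : Equiv.Perm (Fin n) × Equiv.Perm (Fin n) × Equiv.Perm (Fin n) // IsTransitiveTriple t}

/-- A transitive permutation representation of `Delta` whose generating involutions act without
fixed points determines a transitive triple. -/
def TransitiveTriple.ofHom (ρ : Delta →* Equiv.Perm (Fin n)) (hfix : ∀ i x, ρ (gen i) x ≠ x)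
    (htrans : ∀ x y, ∃ g, ρ g x = y) : TransitiveTriple n :=
  ⟨(ρ (gen 0), ρ (gen 1), ρ (gen 2)), by
    have hfam : tripleFamily (ρ (gen 0), ρ (gen 1), ρ (gen 2)) = fun i => ρ (gen i) := by
      funext i
      fin_cases i <;> rfl
    have hsq : ∀ i : Fin 3, ρ (gen i) * ρ (gen i) = 1 := fun i => by
      rw [← map_mul, gen_mul_self, map_one]
    rw [isTransitiveTriple_iff, hfam]
    refine ⟨fun i => ⟨hsq i, hfix i⟩, fun x y => ?_⟩
    obtain ⟨g, hg⟩ := htrans x y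
    refine ⟨ρ g, ?_, hg⟩
    rw [← range_lift _ hsq, show lift (fun i => ρ (gen i)) hsq = ρ from
      hom_ext fun i => lift_gen _ _ i]
    exact ⟨g, rfl⟩⟩

namespace TransitiveTriple

/-- The permutation representation of `Delta` determined by a transitive triple. -/
def toHom (t : TransitiveTriple n) : Delta →* Equiv.Perm (Fin n) :=
  lift (tripleFamily t.1) fun i => (((isTransitiveTriple_iff t.1).mp t.2).1 i).1

theorem toHom_gen (t : TransitiveTriple n) (i : Fin 3) : t.toHom (gen i) = tripleFamily t.1 i :=
  lift_gen _ _ i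

theorem toHom_gen_ne (t : TransitiveTriple n) (i : Fin 3) (x : Fin n) : t.toHom (gen i) x ≠ x := by
  rw [toHom_gen]
  exact (((isTransitiveTriple_iff t.1).mp t.2).1 i).2 x

theorem exists_toHom_apply_eq (t : TransitiveTriple n) (x y : Fin n) : ∃ g, t.toHom g x = y := by
  obtain ⟨_, hg, hxy⟩ := ((isTransitiveTriple_iff t.1).mp t.2).2 x y
  rw [← range_lift _ fun i => (((isTransitiveTriple_iff t.1).mp t.2).1 i).1] at hg
  obtain ⟨g, rfl⟩ := hg
  exact ⟨g, hxy⟩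

theorem toHom_ofHom (ρ : Delta →* Equiv.Perm (Fin n)) (hfix : ∀ i x, ρ (gen i) x ≠ x)
    (htrans : ∀ x y, ∃ g, ρ g x = y) : (ofHom ρ hfix htrans).toHom = ρ :=
  hom_ext fun i => by
    rw [toHom_gen]
    fin_cases i <;> rfl

theorem toHom_eq_conj_iff (t s : TransitiveTriple n) (π : Equiv.Perm (Fin n)) :
    (∀ g, π * t.toHom g * π⁻¹ = s.toHom g) ↔
      π * t.1.1 * π⁻¹ = s.1.1 ∧ π * t.1.2.1 * π⁻¹ = s.1.2.1 ∧ π * t.1.2.2 * π⁻¹ = s.1.2.2 := by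
  have h : (∀ g, π * t.toHom g * π⁻¹ = s.toHom g) ↔
      ∀ i, π * tripleFamily t.1 i * π⁻¹ = tripleFamily s.1 i := by
    constructor
    · intro h i
      simpa only [toHom_gen] using h (gen i)
    · intro h
      have : (MulAut.conj π).toMonoidHom.comp t.toHom = s.toHom := hom_ext fun i => by
        rw [toHom_gen, ← h i, ← toHom_gen]
        rfl
      exact fun g => DFunLike.congr_fun this g
  rw [h, Fin.forall_fin_succ, Fin.forall_fin_succ, Fin.forall_fin_succ]
  simp [tripleFamily]

/-- Relabelling of a transitive triple along a permutation. -/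
def conjBy (π : Equiv.Perm (Fin n)) (t : TransitiveTriple n) : TransitiveTriple n :=
  ofHom ((MulAut.conj π).toMonoidHom.comp t.toHom)
    (fun i x h => t.toHom_gen_ne i (π⁻¹ x) <| by
      rw [Equiv.Perm.eq_inv_iff_eq]
      exact h)
    (fun x y => by
      obtain ⟨g, hg⟩ := t.exists_toHom_apply_eq (π⁻¹ x) (π⁻¹ y)
      exact ⟨g, (Equiv.Perm.eq_inv_iff_eq (f := π)).mp hg⟩)

theorem toHom_conjBy (π : Equiv.Perm (Fin n)) (t : TransitiveTriple n) (g : Delta) :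
    (conjBy π t).toHom g = π * t.toHom g * π⁻¹ := by
  rw [conjBy, toHom_ofHom]
  rfl

theorem toHom_injective : Function.Injective (toHom : TransitiveTriple n → _) := fun t s h => by
  obtain ⟨h1, h2, h3⟩ := (toHom_eq_conj_iff t s 1).mp fun g => by simp [h]
  ext1
  simp only [one_mul, inv_one, mul_one] at h1 h2 h3
  exact Prod.ext h1 (Prod.ext h2 h3)

theorem conjBy_left_injective_of_fixing_root (t : TransitiveTriple n) (x₀ : Fin n)
    {π σ : Equiv.Perm (Fin n)}
    (hπ : π x₀ = x₀) (hσ : σ x₀ = x₀) (h : conjBy π t = conjBy σ t) : π = σ := by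
  ext1 x
  obtain ⟨g, rfl⟩ := t.exists_toHom_apply_eq x₀ x
  have hg := Equiv.congr_fun (congrArg (fun s : TransitiveTriple n => s.toHom g) h) x₀
  simpa only [toHom_conjBy, Equiv.Perm.mul_apply, Equiv.Perm.inv_eq_iff_eq.mpr hπ.symm,
    Equiv.Perm.inv_eq_iff_eq.mpr hσ.symm] using hg

/-- The subgroup of `Delta` fixing the root `x₀` under the action given by a transitive triple. -/
def rootStabilizer (x₀ : Fin n) (t : TransitiveTriple n) : Subgroup Delta :=
  (MulAction.stabilizer (Equiv.Perm (Fin n)) x₀).comap t.toHom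

theorem mem_rootStabilizer {x₀ : Fin n} {t : TransitiveTriple n} {g : Delta} :
    g ∈ rootStabilizer x₀ t ↔ t.toHom g x₀ = x₀ :=
  Iff.rfl

theorem rootStabilizer_index_and_isFreeGroup (x₀ : Fin n) (t : TransitiveTriple n) :
    (rootStabilizer x₀ t).index = n ∧ IsFreeGroup (rootStabilizer x₀ t) := by
  let _ : MulAction Delta (Fin n) := MulAction.compHom (Fin n) t.toHom
  have : MulAction.IsPretransitive Delta (Fin n) := ⟨t.exists_toHom_apply_eq⟩
  have hstab : rootStabilizer x₀ t = MulAction.stabilizer Delta x₀ := rfl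
  rw [hstab]
  exact ⟨by rw [MulAction.index_stabilizer_of_transitive, Nat.card_fin],
    isFreeGroup_stabilizer t.toHom_gen_ne x₀⟩

theorem rootStabilizer_eq_iff (x₀ : Fin n) (t s : TransitiveTriple n) :
    rootStabilizer x₀ t = rootStabilizer x₀ s ↔
      ∃ π : Equiv.Perm (Fin n), π x₀ = x₀ ∧ ∀ g, π * t.toHom g * π⁻¹ = s.toHom g := by
  constructor
  · intro h
    exact exists_perm_conj_of_stabilizer_eq _ _ x₀ (t.exists_toHom_apply_eq x₀)
      (s.exists_toHom_apply_eq x₀) fun g => SetLike.ext_iff.mp h g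
  · rintro ⟨π, hπ, h⟩
    ext g
    rw [mem_rootStabilizer, mem_rootStabilizer, ← h g, Equiv.Perm.mul_apply, Equiv.Perm.mul_apply,
      Equiv.Perm.inv_eq_iff_eq.mpr hπ.symm]
    nth_rewrite 4 [← hπ]
    exact π.injective.eq_iff.symm

theorem exists_rootStabilizer_eq (x₀ : Fin n) {H : Subgroup Delta} (hindex : H.index = n)
    (hfree : IsFreeGroup H) : ∃ t, rootStabilizer x₀ t = H := by
  have hcard : Nat.card (Delta ⧸ H) = n := hindex
  have : Finite (Delta ⧸ H) := Nat.finite_of_card_ne_zero (by have := x₀.2; omega)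
  let e₀ : Delta ⧸ H ≃ Fin n := Finite.equivFinOfCardEq hcard
  let e : Delta ⧸ H ≃ Fin n := e₀.trans (Equiv.swap (e₀ ((1 : Delta) : Delta ⧸ H)) x₀)
  have he : e ((1 : Delta) : Delta ⧸ H) = x₀ := by simp [e]
  let ρ : Delta →* Equiv.Perm (Fin n) :=
    e.permCongrHom.toMonoidHom.comp (MulAction.toPermHom Delta (Delta ⧸ H))
  have hρ : ∀ g x, ρ g x = e (g • e.symm x) := fun _ _ => rfl
  refine ⟨ofHom ρ (fun i x h => gen_smul_ne hfree i (e.symm x) ?_) fun x y => ?_, ?_⟩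
  · rw [hρ] at h
    exact e.injective (h.trans (e.apply_symm_apply x).symm)
  · obtain ⟨g, hg⟩ := MulAction.exists_smul_eq Delta (e.symm x) (e.symm y)
    exact ⟨g, by rw [hρ, hg, e.apply_symm_apply]⟩
  · ext g
    rw [mem_rootStabilizer, toHom_ofHom, hρ, ← he, e.symm_apply_apply, e.injective.eq_iff,
      MulAction.Quotient.smul_coe, smul_eq_mul, mul_one, eq_comm, QuotientGroup.eq, inv_one,
      one_mul]

end TransitiveTriple

theorem card_perm_fixing_root (x₀ : Fin n) :
    Nat.card {π : Equiv.Perm (Fin n) // π x₀ = x₀} = (n - 1).factorial := by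
  have h := (MulAction.stabilizer (Equiv.Perm (Fin n)) x₀).card_mul_index
  rw [MulAction.index_stabilizer_of_transitive, Nat.card_fin, Nat.card_perm, Nat.card_fin,
    ← Nat.mul_factorial_pred (by have := x₀.2; omega), mul_comm n] at h
  exact Nat.eq_of_mul_eq_mul_right x₀.pos h

end Paving

open TransitiveTriple

/-- Rooted connected pavings on `n` darts (transitive triples with root `0`)
modulo relabellings fixing the root are in bijection with free subgroups of
index `n` in `Δ⁺`; consequently the number of free subgroups of index `n`
equals `c(n)/(n-1)!`. -/
theorem rooted_pavings_classify_free_subgroups (n : ℕ) (hn : 0 < n) :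
    (∃ F : {t : Equiv.Perm (Fin n) × Equiv.Perm (Fin n) × Equiv.Perm (Fin n) //
              IsTransitiveTriple t} →
          {H : Subgroup Delta // H.index = n ∧ IsFreeGroup H},
      Function.Surjective F ∧
      ∀ t s, F t = F s ↔
        ∃ π : Equiv.Perm (Fin n), π ⟨0, hn⟩ = ⟨0, hn⟩ ∧
          π * t.1.1 * π⁻¹ = s.1.1 ∧ π * t.1.2.1 * π⁻¹ = s.1.2.1 ∧
          π * t.1.2.2 * π⁻¹ = s.1.2.2) ∧
    (Nat.card {H : Subgroup Delta // H.index = n ∧ IsFreeGroup H} : ℚ) =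
      (cTrans n : ℚ) / (Nat.factorial (n - 1) : ℚ) := by
  let F : TransitiveTriple n → {H : Subgroup Delta // H.index = n ∧ IsFreeGroup H} :=
    fun t => ⟨rootStabilizer ⟨0, hn⟩ t, rootStabilizer_index_and_isFreeGroup _ t⟩
  have hFsurj : Function.Surjective F := fun ⟨H, hindex, hfree⟩ => by
    obtain ⟨t, ht⟩ := exists_rootStabilizer_eq ⟨0, hn⟩ hindex hfree
    exact ⟨t, Subtype.ext ht⟩
  have hF : ∀ t s, F t = F s ↔ ∃ π : Equiv.Perm (Fin n),
      π ⟨0, hn⟩ = ⟨0, hn⟩ ∧ ∀ g, π * t.toHom g * π⁻¹ = s.toHom g := fun t s => by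
    rw [Subtype.ext_iff]
    exact rootStabilizer_eq_iff _ t s
  refine ⟨⟨F, hFsurj, fun t s => (hF t s).trans (exists_congr fun π =>
    and_congr_right fun _ => toHom_eq_conj_iff t s π)⟩, ?_⟩
  let r := Function.surjInv hFsurj
  have hr : ∀ H, F (r H) = H := Function.surjInv_eq hFsurj
  have hbij : Function.Bijective
      (fun p : {H : Subgroup Delta // H.index = n ∧ IsFreeGroup H} ×
        {π : Equiv.Perm (Fin n) // π ⟨0, hn⟩ = ⟨0, hn⟩} => conjBy p.2.1 (r p.1)) := by
    constructor
    · rintro ⟨H, π, hπ⟩ ⟨K, σ, hσ⟩ h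
      have hrel : ∀ (H) (π : Equiv.Perm (Fin n)), π ⟨0, hn⟩ = ⟨0, hn⟩ →
          F (conjBy π (r H)) = H := fun H π hπ => by
        rw [← (hF (r H) _).mpr ⟨π, hπ, fun g => (toHom_conjBy π _ g).symm⟩, hr]
      obtain rfl : H = K := by
        rw [← hrel H π hπ, ← hrel K σ hσ]
        exact congrArg F h
      obtain rfl : π = σ := conjBy_left_injective_of_fixing_root _ _ hπ hσ h
      rfl
    · intro t
      obtain ⟨π, hπ, h⟩ := (hF (r (F t)) t).mp (hr (F t))
      exact ⟨(F t, ⟨π, hπ⟩), toHom_injective <| MonoidHom.ext fun g => by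
        rw [toHom_conjBy, h]⟩
  have hcard := Nat.card_congr (Equiv.ofBijective _ hbij)
  rw [Nat.card_prod, card_perm_fixing_root] at hcard
  rw [eq_div_iff (Nat.cast_ne_zero.mpr (Nat.factorial_ne_zero _)), cTrans, ← hcard, Nat.cast_mul]
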